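/- arXiv:1102.1274 — 8 statements merged into one kernel-verified Lean document; each statement's English description precedes it below -/
import Mathlib

section
/- Let μ : ℝ³×ℝ³ → ℝ³ be smooth, written μ(M,γ) = (μ₁,μ₂,μ₃). The matrix field Π_μ satisfies the Jacobi identity if and only if for all (M,γ) ∈ ℝ³×ℝ³ the following hold: (i) γ × ∇_M μ_k(M,γ) = 0 for k = 1,2,3, and (ii) γ · curl_γ μ(M,γ) + M · curl_M μ(M,γ) + μ(M,γ) · curl_M μ(M,γ) = 0, where ∇_M and curl_M denote the gradient and curl taken in the M-variables (γ fixed) and curl_γ the curl in the γ-variables (M fixed). -/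
open Matrix

noncomputable section

/-- ℝ³ as triples of reals. -/
abbrev V3 : Type := Fin 3 → ℝ

/-- The cross product on ℝ³. -/
def cross3 (a b : V3) : V3 :=
  ![a 1 * b 2 - a 2 * b 1, a 2 * b 0 - a 0 * b 2, a 0 * b 1 - a 1 * b 0]

/-- The hat map: `hat v` is the skew 3×3 matrix with `hat v * u = v × u`. -/
def hat (v : V3) : Matrix (Fin 3) (Fin 3) ℝ :=
  !![0, -(v 2), v 1; v 2, 0, -(v 0); -(v 1), v 0, 0]

/-- The matrix field Π_μ on ℝ⁶ = ℝ³ × ℝ³, in block form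
`[[hat (M + μ(M,γ)), hat γ], [hat γ, 0]]`. -/
def Pim (μ : V3 × V3 → V3) (p : V3 × V3) :
    Matrix (Fin 3 ⊕ Fin 3) (Fin 3 ⊕ Fin 3) ℝ :=
  Matrix.fromBlocks (hat (p.1 + μ p)) (hat p.2) (hat p.2) 0

/-- The coordinate directions of ℝ⁶ = ℝ³ × ℝ³ (coordinates `(M₁,M₂,M₃,γ₁,γ₂,γ₃)`). -/
def dir : Fin 3 ⊕ Fin 3 → V3 × V3
  | Sum.inl i => (Pi.single i 1, 0)
  | Sum.inr i => (0, Pi.single i 1)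

/-- Π_μ satisfies the Jacobi identity:
`Σ_l (Π^{li} ∂_l Π^{jk} + Π^{lj} ∂_l Π^{ki} + Π^{lk} ∂_l Π^{ij}) = 0` at every point. -/
def JacobiIdentity (μ : V3 × V3 → V3) : Prop :=
  ∀ p : V3 × V3, ∀ i j k : Fin 3 ⊕ Fin 3,
    ∑ l : Fin 3 ⊕ Fin 3,
      (Pim μ p l i * fderiv ℝ (fun q => Pim μ q j k) p (dir l)
        + Pim μ p l j * fderiv ℝ (fun q => Pim μ q k i) p (dir l)
        + Pim μ p l k * fderiv ℝ (fun q => Pim μ q i j) p (dir l)) = 0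

/-- The full gradient ∇C ∈ ℝ⁶ of a function on ℝ³ × ℝ³. -/
def gradFull (C : V3 × V3 → ℝ) (p : V3 × V3) : Fin 3 ⊕ Fin 3 → ℝ :=
  fun l => fderiv ℝ C p (dir l)

/-- `C` is a Casimir of Π_μ : `Π_μ(M,γ) ∇C(M,γ) = 0` everywhere. -/
def IsCasimir (μ : V3 × V3 → V3) (C : V3 × V3 → ℝ) : Prop :=
  ∀ p : V3 × V3, Pim μ p *ᵥ gradFull C p = 0

/-- Gradient in the M-variables (γ fixed) of a function on ℝ³ × ℝ³. -/
def gradM (f : V3 × V3 → ℝ) (p : V3 × V3) : V3 :=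
  fun i => fderiv ℝ f p (Pi.single i 1, 0)

/-- Gradient in the γ-variables (M fixed) of a function on ℝ³ × ℝ³. -/
def gradG (f : V3 × V3 → ℝ) (p : V3 × V3) : V3 :=
  fun i => fderiv ℝ f p (0, Pi.single i 1)

/-- Curl in the M-variables (γ fixed) of a vector field on ℝ³ × ℝ³. -/
def curlM (F : V3 × V3 → V3) (p : V3 × V3) : V3 :=
  ![gradM (fun q => F q 2) p 1 - gradM (fun q => F q 1) p 2,
    gradM (fun q => F q 0) p 2 - gradM (fun q => F q 2) p 0,
    gradM (fun q => F q 1) p 0 - gradM (fun q => F q 0) p 1]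

/-- Curl in the γ-variables (M fixed) of a vector field on ℝ³ × ℝ³. -/
def curlG (F : V3 × V3 → V3) (p : V3 × V3) : V3 :=
  ![gradG (fun q => F q 2) p 1 - gradG (fun q => F q 1) p 2,
    gradG (fun q => F q 0) p 2 - gradG (fun q => F q 2) p 0,
    gradG (fun q => F q 1) p 0 - gradG (fun q => F q 0) p 1]

/-- Gradient of a function on ℝ³. -/
def grad3 (f : V3 → ℝ) (γ : V3) : V3 :=
  fun i => fderiv ℝ f γ (Pi.single i 1)

/-- Curl of a vector field on ℝ³. -/
def curl3 (F : V3 → V3) (γ : V3) : V3 :=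
  ![grad3 (fun x => F x 2) γ 1 - grad3 (fun x => F x 1) γ 2,
    grad3 (fun x => F x 0) γ 2 - grad3 (fun x => F x 2) γ 0,
    grad3 (fun x => F x 1) γ 0 - grad3 (fun x => F x 0) γ 1]

/-- Divergence of a vector field on ℝ³. -/
def div3 (F : V3 → V3) (γ : V3) : ℝ :=
  ∑ i : Fin 3, grad3 (fun x => F x i) γ i

/-- For functions of (γ, s) ∈ ℝ³ × ℝ : gradient in γ at fixed s. -/
def gradg (f : V3 × ℝ → ℝ) (q : V3 × ℝ) : V3 :=
  fun i => fderiv ℝ f q (Pi.single i 1, 0)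

/-- For vector fields of (γ, s) ∈ ℝ³ × ℝ : curl in γ at fixed s. -/
def curlg (F : V3 × ℝ → V3) (q : V3 × ℝ) : V3 :=
  ![gradg (fun x => F x 2) q 1 - gradg (fun x => F x 1) q 2,
    gradg (fun x => F x 0) q 2 - gradg (fun x => F x 2) q 0,
    gradg (fun x => F x 1) q 0 - gradg (fun x => F x 0) q 1]

/-- ∂₄: partial derivative with respect to the fourth variable s, for a vector field ν(γ,s). -/
def d4 (F : V3 × ℝ → V3) (q : V3 × ℝ) : V3 :=
  fun k => fderiv ℝ (fun x => F x k) q (0, 1)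

/-- ∂₄: partial derivative with respect to the fourth variable s, for a scalar function D(γ,s). -/
def d4s (f : V3 × ℝ → ℝ) (q : V3 × ℝ) : ℝ :=
  fderiv ℝ f q (0, 1)

theorem hat_apply_eq_sum (v : V3) (i j : Fin 3) :
    hat v i j = ∑ k, v k * hat (Pi.single k 1) i j := by
  fin_cases i <;> fin_cases j <;> simp [hat, Pi.single_apply]

theorem fderiv_hat_apply {F : V3 × V3 → V3} {p : V3 × V3}
    (hF : ∀ k, DifferentiableAt ℝ (fun q => F q k) p) (i j : Fin 3) (v : V3 × V3) :
    fderiv ℝ (fun q => hat (F q) i j) p v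
      = hat (fun k => fderiv ℝ (fun q => F q k) p v) i j := by
  have h : HasFDerivAt (fun q => ∑ k, F q k * hat (Pi.single k 1) i j)
      (∑ k, hat (Pi.single k 1) i j • fderiv ℝ (fun q => F q k) p) p :=
    HasFDerivAt.fun_sum fun k _ => (hF k).hasFDerivAt.mul_const _
  simp only [hat_apply_eq_sum (F _) i j, h.fderiv]
  rw [hat_apply_eq_sum]
  simp [mul_comm]

/-- The derivative of `Π_μ` along `v` has the same block form as `Π_μ` itself. -/
theorem fderiv_Pim_apply {μ : V3 × V3 → V3} (hμ : Differentiable ℝ μ) (p v : V3 × V3)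
    (i j : Fin 3 ⊕ Fin 3) :
    fderiv ℝ (fun q => Pim μ q i j) p v
      = Matrix.fromBlocks (hat (v.1 + fun k => fderiv ℝ (fun q => μ q k) p v))
          (hat v.2) (hat v.2) 0 i j := by
  have hμk (k : Fin 3) : DifferentiableAt ℝ (fun q => μ q k) p := by fun_prop
  have h1 (k : Fin 3) : HasFDerivAt (fun q : V3 × V3 => q.1 k)
      ((ContinuousLinearMap.proj k).comp (ContinuousLinearMap.fst ℝ V3 V3)) p :=
    ((ContinuousLinearMap.proj (R := ℝ) (φ := fun _ : Fin 3 => ℝ) k).comp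
      (ContinuousLinearMap.fst ℝ V3 V3)).hasFDerivAt
  have h2 (k : Fin 3) : HasFDerivAt (fun q : V3 × V3 => q.2 k)
      ((ContinuousLinearMap.proj k).comp (ContinuousLinearMap.snd ℝ V3 V3)) p :=
    ((ContinuousLinearMap.proj (R := ℝ) (φ := fun _ : Fin 3 => ℝ) k).comp
      (ContinuousLinearMap.snd ℝ V3 V3)).hasFDerivAt
  have hγ (a b : Fin 3) : fderiv ℝ (fun q : V3 × V3 => hat q.2 a b) p v = hat v.2 a b := by
    rw [fderiv_hat_apply fun k => (h2 k).differentiableAt]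
    simp only [(h2 _).fderiv]
    rfl
  rcases i with i | i <;> rcases j with j | j
  · simp only [Pim, Matrix.fromBlocks_apply₁₁]
    have h3 (k : Fin 3) : HasFDerivAt (fun q : V3 × V3 => (q.1 + μ q) k) _ p :=
      (h1 k).add (hμk k).hasFDerivAt
    rw [fderiv_hat_apply fun k => (h3 k).differentiableAt]
    simp only [(h3 _).fderiv]
    rfl
  · exact hγ i j
  · exact hγ i j
  · simp [Pim]

theorem hat_eq_zero_iff {v : V3} : hat v = 0 ↔ v = 0 := by
  constructor
  · intro h
    have h0 := congrFun₂ h 2 1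
    have h1 := congrFun₂ h 0 2
    have h2 := congrFun₂ h 1 0
    simp only [hat, Matrix.of_apply, Matrix.cons_val, Matrix.zero_apply] at h0 h1 h2
    ext k
    fin_cases k <;> simpa
  · rintro rfl
    ext i j
    fin_cases i <;> fin_cases j <;> simp [hat]

/-- The left-hand side of the Jacobi identity for `Π_μ`. -/
def jacobiator (μ : V3 × V3 → V3) (p : V3 × V3) (i j k : Fin 3 ⊕ Fin 3) : ℝ :=
  ∑ l : Fin 3 ⊕ Fin 3,
    (Pim μ p l i * fderiv ℝ (fun q => Pim μ q j k) p (dir l)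
      + Pim μ p l j * fderiv ℝ (fun q => Pim μ q k i) p (dir l)
      + Pim μ p l k * fderiv ℝ (fun q => Pim μ q i j) p (dir l))

theorem jacobiator_rotate (μ : V3 × V3 → V3) (p : V3 × V3) (i j k : Fin 3 ⊕ Fin 3) :
    jacobiator μ p i j k = jacobiator μ p j k i :=
  Finset.sum_congr rfl fun _ _ => by ring

theorem jacobiator_inl_inl_inl {μ : V3 × V3 → V3} (hμ : Differentiable ℝ μ) (p : V3 × V3)
    (i j k : Fin 3) :
    jacobiator μ p (Sum.inl i) (Sum.inl j) (Sum.inl k)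
      = -(p.2 ⬝ᵥ curlG μ p + p.1 ⬝ᵥ curlM μ p + μ p ⬝ᵥ curlM μ p)
          * hat (Pi.single i 1) j k := by
  simp only [jacobiator, fderiv_Pim_apply hμ]
  simp only [Pim, Fintype.sum_sum_type, dir,
    Matrix.fromBlocks_apply₁₁, Matrix.fromBlocks_apply₂₁, dotProduct, Fin.sum_univ_three,
    curlG, curlM, gradG, gradM]
  fin_cases i <;> fin_cases j <;> fin_cases k <;> simp [hat] <;> ring

theorem jacobiator_inl_inl_inr {μ : V3 × V3 → V3} (hμ : Differentiable ℝ μ) (p : V3 × V3)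
    (i j k : Fin 3) :
    jacobiator μ p (Sum.inl i) (Sum.inl j) (Sum.inr k)
      = -hat (fun m => cross3 p.2 (gradM (fun q => μ q m) p) k) i j := by
  simp only [jacobiator, fderiv_Pim_apply hμ]
  simp only [Pim, Fintype.sum_sum_type, dir,
    Matrix.fromBlocks_apply₁₁, Matrix.fromBlocks_apply₂₁, Matrix.fromBlocks_apply₁₂,
    Matrix.fromBlocks_apply₂₂, Fin.sum_univ_three, cross3, gradM]
  fin_cases i <;> fin_cases j <;> fin_cases k <;> simp [hat] <;> ring

theorem jacobiator_inr_inr {μ : V3 × V3 → V3} (hμ : Differentiable ℝ μ) (p : V3 × V3)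
    (i : Fin 3 ⊕ Fin 3) (j k : Fin 3) :
    jacobiator μ p i (Sum.inr j) (Sum.inr k) = 0 := by
  have h0 : hat 0 = 0 := hat_eq_zero_iff.2 rfl
  simp only [jacobiator, fderiv_Pim_apply hμ]
  rcases i with i | i <;> simp [Pim, dir, h0]

/-- Π_μ satisfies the Jacobi identity iff γ × ∇_M μ_k = 0 for k=1,2,3 and
γ·curl_γ μ + M·curl_M μ + μ·curl_M μ = 0, at every point. -/
theorem statement0 (μ : V3 × V3 → V3) (hμ : ContDiff ℝ (⊤ : ℕ∞) μ) :
    JacobiIdentity μ ↔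
      ∀ p : V3 × V3,
        (∀ k : Fin 3, cross3 p.2 (gradM (fun q => μ q k) p) = 0) ∧
        p.2 ⬝ᵥ curlG μ p + p.1 ⬝ᵥ curlM μ p + μ p ⬝ᵥ curlM μ p = 0 := by
  have hd : Differentiable ℝ μ := hμ.differentiable (by simp)
  refine forall_congr' fun p => ?_
  change (∀ i j k, jacobiator μ p i j k = 0) ↔ _
  constructor
  · intro h
    constructor
    · intro m
      ext k
      have hk : hat (fun m => cross3 p.2 (gradM (fun q => μ q m) p) k) = 0 := by
        ext i j
        exact neg_eq_zero.1 ((jacobiator_inl_inl_inr hd p i j k).symm.trans (h _ _ _))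
      exact congrFun (hat_eq_zero_iff.1 hk) m
    · simpa [jacobiator_inl_inl_inl hd, hat] using h (Sum.inl 0) (Sum.inl 1) (Sum.inl 2)
  · rintro ⟨hM, hS⟩
    have hMMG (i j k : Fin 3) : jacobiator μ p (Sum.inl i) (Sum.inl j) (Sum.inr k) = 0 := by
      rw [jacobiator_inl_inl_inr hd, neg_eq_zero,
        hat_eq_zero_iff.2 (funext fun m => congrFun (hM m) k), Matrix.zero_apply]
    rintro (i | i) (j | j) (k | k)
    · rw [jacobiator_inl_inl_inl hd, hS, neg_zero, zero_mul]
    · exact hMMG i j k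
    · rw [← jacobiator_rotate, hMMG]
    · exact jacobiator_inr_inr hd p _ j k
    · rw [jacobiator_rotate, hMMG]
    · rw [jacobiator_rotate, jacobiator_inr_inr hd]
    · rw [← jacobiator_rotate, jacobiator_inr_inr hd]
    · exact jacobiator_inr_inr hd p _ j k
end
end

section
/- Let f : ℝ³×ℝ³ → ℝ be smooth, with arguments written (M,γ), and suppose that γ × ∇_M f(M,γ) = 0 for all M ∈ ℝ³ and all γ ∈ ℝ³ with γ ≠ 0, where ∇_M f denotes the gradient of f in the M-variables with γ fixed. Then for every γ ≠ 0 and all M, M′ ∈ ℝ³ with M·γ = M′·γ one has f(M,γ) = f(M′,γ); that is, f(M,γ) depends on M only through the scalar product M·γ. -/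
open Matrix

noncomputable section

/-- A vector orthogonal to `γ ≠ 0` is orthogonal to every vector parallel to `γ`. -/
theorem dotProduct_eq_zero_of_cross3_eq_zero {γ g v : V3} (hγ : γ ≠ 0)
    (hg : cross3 γ g = 0) (hv : v ⬝ᵥ γ = 0) : v ⬝ᵥ g = 0 := by
  have h0 := congrFun hg 0
  have h1 := congrFun hg 1
  have h2 := congrFun hg 2
  simp only [cross3, cons_val_zero, cons_val_one, cons_val, Pi.zero_apply] at h0 h1 h2
  have key : (γ ⬝ᵥ γ) * (v ⬝ᵥ g) = 0 := by
    simp only [dotProduct, Fin.sum_univ_three] at hv ⊢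
    linear_combination (γ 0 * g 0 + γ 1 * g 1 + γ 2 * g 2) * hv
      - (v 1 * γ 2 - v 2 * γ 1) * h0 - (v 2 * γ 0 - v 0 * γ 2) * h1
      - (v 0 * γ 1 - v 1 * γ 0) * h2
  exact (mul_eq_zero.mp key).resolve_left (dotProduct_self_eq_zero.not.mpr hγ)

/-- The derivative in a direction `(v, 0)` is the scalar product of `v` with the `M`-gradient. -/
theorem fderiv_apply_prodMk_zero (f : V3 × V3 → ℝ) (p : V3 × V3) (v : V3) :
    fderiv ℝ f p (v, 0) = v ⬝ᵥ gradM f p := by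
  have hv : ((v, 0) : V3 × V3) = ∑ i, v i • ((Pi.single i 1, 0) : V3 × V3) := by
    ext j <;> fin_cases j <;> simp [Fin.sum_univ_three]
  rw [hv, map_sum]
  simp only [map_smul, smul_eq_mul, dotProduct, gradM]

/-- If γ × ∇_M f(M,γ) = 0 for all M and all γ ≠ 0, then for γ ≠ 0 the value f(M,γ)
depends on M only through M·γ. -/
theorem statement1 (f : V3 × V3 → ℝ) (hf : ContDiff ℝ (⊤ : ℕ∞) f)
    (h : ∀ (M γ : V3), γ ≠ 0 → cross3 γ (gradM f (M, γ)) = 0) :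
    ∀ γ : V3, γ ≠ 0 → ∀ M M' : V3, M ⬝ᵥ γ = M' ⬝ᵥ γ → f (M, γ) = f (M', γ) := by
  intro γ hγ M M' hM
  have hv : (M' - M) ⬝ᵥ γ = 0 := by rw [sub_dotProduct, hM, sub_self]
  have hderiv (t : ℝ) : HasDerivAt (fun t : ℝ => f (M + t • (M' - M), γ)) 0 t := by
    have hline : HasDerivAt (fun t : ℝ => (M + t • (M' - M), γ)) (M' - M, (0 : V3)) t := by
      refine HasDerivAt.prodMk ?_ (hasDerivAt_const t γ)
      simpa using ((hasDerivAt_id t).smul_const (M' - M)).const_add M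
    have hf' := (hf.differentiable (by simp) (M + t • (M' - M), γ)).hasFDerivAt
    have hcomp := hf'.comp_hasDerivAt t hline
    rwa [fderiv_apply_prodMk_zero,
      dotProduct_eq_zero_of_cross3_eq_zero hγ (h _ γ hγ) hv] at hcomp
  simpa using is_const_of_deriv_eq_zero (fun t => (hderiv t).differentiableAt)
    (fun t => (hderiv t).deriv) 0 1
end
end

section
/- Let ν : ℝ³×ℝ → ℝ³ and D : ℝ³×ℝ → ℝ be smooth, with arguments written (γ,s), and define μ(M,γ) = ν(γ, M·γ) and C(M,γ) = D(γ, M·γ). Then C is a Casimir of Π_μ (i.e. Π_μ(M,γ)∇C(M,γ) = 0 for all (M,γ)) if and only if the Casimir condition equation γ × ( ∂₄D(γ,s) · ν(γ,s) − ∇_γ D(γ,s) ) = 0 holds for all (γ,s) ∈ ℝ³×ℝ, where ∇_γ D is the gradient of D(·,s) in the γ-variables at fixed s and ∂₄D is the partial derivative of D with respect to the fourth variable s. -/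
open Matrix

noncomputable section

lemma hat_mulVec (a u : V3) : hat a *ᵥ u = cross3 a u := by
  ext i
  fin_cases i <;> simp [hat, cross3, Matrix.mulVec, dotProduct, Fin.sum_univ_three] <;> ring

lemma Pim_mulVec (μ : V3 × V3 → V3) (p : V3 × V3) (v : Fin 3 ⊕ Fin 3 → ℝ) :
    Pim μ p *ᵥ v =
      Sum.elim (cross3 (p.1 + μ p) (v ∘ Sum.inl) + cross3 p.2 (v ∘ Sum.inr))
        (cross3 p.2 (v ∘ Sum.inl)) := by
  simp [Pim, Matrix.fromBlocks_mulVec, hat_mulVec]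

lemma fderiv_comp_dotProduct {D : V3 × ℝ → ℝ} (hD : Differentiable ℝ D) (p v : V3 × V3) :
    fderiv ℝ (fun p : V3 × V3 => D (p.2, p.1 ⬝ᵥ p.2)) p v =
      fderiv ℝ D (p.2, p.1 ⬝ᵥ p.2) (v.2, 0) +
        (v.1 ⬝ᵥ p.2 + p.1 ⬝ᵥ v.2) * d4s D (p.2, p.1 ⬝ᵥ p.2) := by
  have hfst (i : Fin 3) : HasFDerivAt (fun q : V3 × V3 => q.1 i)
      ((ContinuousLinearMap.proj i).comp (ContinuousLinearMap.fst ℝ V3 V3)) p :=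
    ((ContinuousLinearMap.proj i).comp (ContinuousLinearMap.fst ℝ V3 V3)).hasFDerivAt
  have hsnd (i : Fin 3) : HasFDerivAt (fun q : V3 × V3 => q.2 i)
      ((ContinuousLinearMap.proj i).comp (ContinuousLinearMap.snd ℝ V3 V3)) p :=
    ((ContinuousLinearMap.proj i).comp (ContinuousLinearMap.snd ℝ V3 V3)).hasFDerivAt
  have hdot := HasFDerivAt.fun_sum (u := Finset.univ) fun i _ => (hfst i).mul (hsnd i)
  have hpair := (hasFDerivAt_snd (𝕜 := ℝ) (p := p)).prodMk hdot
  have hcomp := (hD (p.2, p.1 ⬝ᵥ p.2)).hasFDerivAt.comp p hpair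
  have hsplit (L : V3 × ℝ →L[ℝ] ℝ) (w : V3) (c : ℝ) : L (w, c) = L (w, 0) + c * L (0, 1) := by
    rw [← smul_eq_mul, ← map_smul, ← map_add]
    simp
  have hfderiv : fderiv ℝ (fun p : V3 × V3 => D (p.2, p.1 ⬝ᵥ p.2)) p = _ := hcomp.fderiv
  rw [hfderiv]
  simp only [ContinuousLinearMap.comp_apply, ContinuousLinearMap.prod_apply]
  rw [hsplit, d4s]
  congr 2
  simp only [_root_.sum_apply, _root_.add_apply,
    _root_.smul_apply, ContinuousLinearMap.comp_apply,
    ContinuousLinearMap.proj_apply, ContinuousLinearMap.coe_fst', ContinuousLinearMap.coe_snd',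
    smul_eq_mul, dotProduct, ← Finset.sum_add_distrib]
  exact Finset.sum_congr rfl fun i _ => by ring

lemma gradFull_comp_dotProduct {D : V3 × ℝ → ℝ} (hD : Differentiable ℝ D) (p : V3 × V3) :
    gradFull (fun p => D (p.2, p.1 ⬝ᵥ p.2)) p =
      Sum.elim (d4s D (p.2, p.1 ⬝ᵥ p.2) • p.2)
        (gradg D (p.2, p.1 ⬝ᵥ p.2) + d4s D (p.2, p.1 ⬝ᵥ p.2) • p.1) := by
  ext (i | i)
  · simp [gradFull, dir, fderiv_comp_dotProduct hD, mul_comm, ← Prod.zero_eq_mk]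
  · simp [gradFull, dir, fderiv_comp_dotProduct hD, gradg, mul_comm]

lemma Pim_mulVec_gradFull_comp_dotProduct (ν : V3 × ℝ → V3) {D : V3 × ℝ → ℝ}
    (hD : Differentiable ℝ D) (p : V3 × V3) :
    Pim (fun p => ν (p.2, p.1 ⬝ᵥ p.2)) p *ᵥ gradFull (fun p => D (p.2, p.1 ⬝ᵥ p.2)) p =
      Sum.elim (-cross3 p.2 (d4s D (p.2, p.1 ⬝ᵥ p.2) • ν (p.2, p.1 ⬝ᵥ p.2)
        - gradg D (p.2, p.1 ⬝ᵥ p.2))) 0 := by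
  rw [Pim_mulVec, gradFull_comp_dotProduct hD, Sum.elim_comp_inl, Sum.elim_comp_inr]
  congr 1 <;> ext i <;> fin_cases i <;> simp [cross3] <;> ring

lemma exists_dotProduct_eq {γ : V3} (hγ : γ ≠ 0) (s : ℝ) : ∃ M : V3, M ⬝ᵥ γ = s :=
  ⟨(s / (γ ⬝ᵥ γ)) • γ, by
    rw [smul_dotProduct, smul_eq_mul, div_mul_cancel₀ s (dotProduct_self_eq_zero.not.2 hγ)]⟩

/-- For μ(M,γ) = ν(γ, M·γ) and C(M,γ) = D(γ, M·γ), C is a Casimir of Π_μ iff the Casimir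
condition equation γ × (∂₄D · ν − ∇_γ D) = 0 holds everywhere. -/
theorem statement4 (ν : V3 × ℝ → V3) (D : V3 × ℝ → ℝ)
    (hν : ContDiff ℝ (⊤ : ℕ∞) ν) (hD : ContDiff ℝ (⊤ : ℕ∞) D) :
    IsCasimir (fun p => ν (p.2, p.1 ⬝ᵥ p.2)) (fun p => D (p.2, p.1 ⬝ᵥ p.2)) ↔
      ∀ (γ : V3) (s : ℝ),
        cross3 γ (d4s D (γ, s) • ν (γ, s) - gradg D (γ, s)) = 0 := by
  have hD' : Differentiable ℝ D := hD.differentiable (by simp)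
  simp only [IsCasimir, Pim_mulVec_gradFull_comp_dotProduct ν hD']
  constructor
  · intro h γ s
    by_cases hγ : γ = 0
    · subst hγ
      simp [cross3]
    · obtain ⟨M, rfl⟩ := exists_dotProduct_eq hγ s
      exact neg_eq_zero.1 <| funext fun i => congrFun (h (M, γ)) (Sum.inl i)
  · intro h p
    rw [h]
    ext (i | i) <;> simp
end
end

section
/- Let μ : ℝ³×ℝ³ → ℝ³ be smooth, 𝕀 = diag(I₁,I₂,I₃) with I₁,I₂,I₃ > 0, and U : ℝ³ → ℝ smooth. Then along every solution t ↦ (M(t),γ(t)) of system (★) defined on an interval, both the Hamiltonian H(M,γ) = (1/2) M·𝕀⁻¹M + U(γ) and the function C₁(M,γ) = (1/2)|γ|² are constant in t. -/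
open Matrix

noncomputable section

/-- 𝕀⁻¹ M for 𝕀 = diag(I₁,I₂,I₃). -/
def diagInv (I1 I2 I3 : ℝ) (M : V3) : V3 := fun j => (![I1, I2, I3] j)⁻¹ * M j

/-- The Hamiltonian H(M,γ) = ½ M·𝕀⁻¹M + U(γ). -/
def Ham (I1 I2 I3 : ℝ) (U : V3 → ℝ) (p : V3 × V3) : ℝ :=
  (1 / 2) * (p.1 ⬝ᵥ diagInv I1 I2 I3 p.1) + U p.2

/-- A real function with zero derivative within an order-connected set is constant on it. -/
theorem eq_of_hasDerivWithinAt_zero {f : ℝ → ℝ} {T : Set ℝ} (hT : T.OrdConnected)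
    (hf : ∀ t ∈ T, HasDerivWithinAt f 0 T t) {t t' : ℝ} (ht : t ∈ T) (ht' : t' ∈ T) :
    f t = f t' := by
  have h := hT.convex.norm_image_sub_le_of_norm_hasDerivWithin_le (C := 0) hf
    (fun _ _ => by simp) ht' ht
  rw [zero_mul, norm_le_zero_iff, sub_eq_zero] at h
  exact h

/-- The Fréchet derivative of a function on ℝ³ pairs the gradient with the direction. -/
theorem fderiv_apply_eq_sum_grad3 (f : V3 → ℝ) (x v : V3) :
    fderiv ℝ f x v = v 0 * grad3 f x 0 + v 1 * grad3 f x 1 + v 2 * grad3 f x 2 := by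
  conv_lhs => rw [pi_eq_sum_univ' v]
  simp [Fin.sum_univ_three, grad3]

/-- Along every solution of system (★) on an interval, the Hamiltonian H and
C₁(M,γ) = ½|γ|² are constant. -/
theorem statement6 (μ : V3 × V3 → V3) (hμ : ContDiff ℝ (⊤ : ℕ∞) μ)
    (I1 I2 I3 : ℝ) (h1 : 0 < I1) (h2 : 0 < I2) (h3 : 0 < I3)
    (U : V3 → ℝ) (hU : ContDiff ℝ (⊤ : ℕ∞) U)
    (T : Set ℝ) (hT : T.OrdConnected) (M γ : ℝ → V3)
    (hsol : ∀ t ∈ T,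
      HasDerivWithinAt M
        (-(cross3 (diagInv I1 I2 I3 (M t)) (M t + μ (M t, γ t))) +
          cross3 (γ t) (grad3 U (γ t))) T t ∧
      HasDerivWithinAt γ (cross3 (γ t) (diagInv I1 I2 I3 (M t))) T t) :
    ∀ t ∈ T, ∀ t' ∈ T,
      Ham I1 I2 I3 U (M t, γ t) = Ham I1 I2 I3 U (M t', γ t') ∧
      (1 / 2) * (γ t ⬝ᵥ γ t) = (1 / 2) * (γ t' ⬝ᵥ γ t') := by
  intro t ht t' ht'
  refine ⟨eq_of_hasDerivWithinAt_zero (f := fun t => Ham I1 I2 I3 U (M t, γ t)) hT ?_ ht ht',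
    eq_of_hasDerivWithinAt_zero (f := fun t => (1 / 2) * (γ t ⬝ᵥ γ t)) hT ?_ ht ht'⟩
  · intro s hs
    obtain ⟨hM, hγ⟩ := hsol s hs
    have hUγ := ((hU.differentiable (by simp)) (γ s)).hasFDerivAt.comp_hasDerivWithinAt s hγ
    rw [fderiv_apply_eq_sum_grad3] at hUγ
    rw [hasDerivWithinAt_pi] at hM
    have hsq := fun i => (hM i).mul ((hM i).const_mul (![I1, I2, I3] i)⁻¹)
    have h := ((((hsq 0).add (hsq 1)).add (hsq 2)).const_mul (1 / 2)).add hUγ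
    refine (h.congr_of_mem (fun r _ => ?_) hs).congr_deriv ?_
    · simp [Ham, diagInv, dotProduct, Fin.sum_univ_three]
    · simp [cross3, diagInv]
      ring
  · intro s hs
    have hγ := hasDerivWithinAt_pi.mp (hsol s hs).2
    have hsq := fun i => (hγ i).mul (hγ i)
    have h := (((hsq 0).add (hsq 1)).add (hsq 2)).const_mul (1 / 2)
    refine (h.congr_of_mem (fun r _ => ?_) hs).congr_deriv ?_
    · simp [dotProduct, Fin.sum_univ_three]
    · simp [cross3]
      ring
end
end

section
/- Let ψ : ℝ³ → ℝ and φ : ℝ³ → ℝ be smooth and define μ(M,γ) = ψ(γ)γ + ∇_γφ(γ) (independent of M). Then the function C(M,γ) = M·γ + φ(γ) is a Casimir of Π_μ, i.e. Π_μ(M,γ)∇C(M,γ) = 0 for all (M,γ) ∈ ℝ³×ℝ³. -/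
open Matrix

noncomputable section

/-- The full gradient of `M·γ + φ(γ)` is `(γ, M + ∇φ(γ))`. -/
theorem gradFull_dotProduct_add {φ : V3 → ℝ} {p : V3 × V3} (hφ : DifferentiableAt ℝ φ p.2) :
    gradFull (fun q => q.1 ⬝ᵥ q.2 + φ q.2) p = Sum.elim p.2 (p.1 + grad3 φ p.2) := by
  have h₁ (i : Fin 3) : HasFDerivAt (fun q : V3 × V3 => q.1 i)
      ((ContinuousLinearMap.proj i).comp (ContinuousLinearMap.fst ℝ V3 V3)) p :=
    ((ContinuousLinearMap.proj (R := ℝ) (φ := fun _ : Fin 3 => ℝ) i).comp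
      (ContinuousLinearMap.fst ℝ V3 V3)).hasFDerivAt
  have h₂ (i : Fin 3) : HasFDerivAt (fun q : V3 × V3 => q.2 i)
      ((ContinuousLinearMap.proj i).comp (ContinuousLinearMap.snd ℝ V3 V3)) p :=
    ((ContinuousLinearMap.proj (R := ℝ) (φ := fun _ : Fin 3 => ℝ) i).comp
      (ContinuousLinearMap.snd ℝ V3 V3)).hasFDerivAt
  have h : HasFDerivAt (fun q : V3 × V3 => q.1 ⬝ᵥ q.2 + φ q.2) _ p :=
    (HasFDerivAt.fun_sum fun i (_ : i ∈ Finset.univ) => (h₁ i).mul (h₂ i)).add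
      (hφ.hasFDerivAt.comp p hasFDerivAt_snd)
  funext l
  rw [gradFull, h.fderiv]
  rcases l with i | i <;> simp [dir, grad3, Pi.single_apply]

/-- For μ(γ) = ψ(γ)γ + ∇_γφ(γ), the function C(M,γ) = M·γ + φ(γ) is a Casimir of Π_μ. -/
theorem statement10 (ψ φ : V3 → ℝ)
    (hψ : ContDiff ℝ (⊤ : ℕ∞) ψ) (hφ : ContDiff ℝ (⊤ : ℕ∞) φ) :
    IsCasimir (fun p => ψ p.2 • p.2 + grad3 φ p.2)
      (fun p => p.1 ⬝ᵥ p.2 + φ p.2) := by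
  intro p
  rw [gradFull_dotProduct_add (hφ.differentiable (by simp) p.2), Pim, fromBlocks_mulVec]
  ext (i | i) <;> fin_cases i <;>
    simp [hat, dotProduct, Fin.sum_univ_three] <;> ring
end
end

section
/- Let A be a real 3×3 matrix and μ₀ ∈ ℝ³ a constant vector, and define μ(γ) = Aγ + μ₀. Then γ · curl_γ μ(γ) = 0 for all γ ∈ ℝ³ (equivalently, Π_μ satisfies the Jacobi identity) if and only if A is symmetric, A = Aᵀ. -/
open Matrix

noncomputable section

/-- An affine function on a finite-dimensional space has its linear part as derivative. -/
theorem fderiv_apply_of_linear_add_const {E : Type*} [NormedAddCommGroup E] [NormedSpace ℝ E]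
    [FiniteDimensional ℝ E] {f g : E → ℝ} (hg : IsLinearMap ℝ g) (c : ℝ)
    (hf : ∀ x, f x = g x + c) (p v : E) : fderiv ℝ f p v = g v := by
  have h : f = fun x => LinearMap.toContinuousLinearMap (hg.mk' g) x + c := by
    funext x
    simp [hf]
  rw [h, fderiv_add_const, ContinuousLinearMap.fderiv]
  rfl

theorem grad3_affine (A : Matrix (Fin 3) (Fin 3) ℝ) (μ0 γ : V3) (k i : Fin 3) :
    grad3 (fun x => (A *ᵥ x + μ0) k) γ i = A k i := by
  have hg : IsLinearMap ℝ (fun x : V3 => (A *ᵥ x) k) :=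
    ⟨fun x y => by simp [mulVec_add], fun c x => by simp [mulVec_smul]⟩
  have h := fderiv_apply_of_linear_add_const (f := fun x => (A *ᵥ x + μ0) k) hg (μ0 k)
    (fun x => rfl) γ (Pi.single i 1)
  exact h.trans (by simp)

theorem hat_zero : hat 0 = 0 := by
  ext i j
  fin_cases i <;> fin_cases j <;> simp [hat]

theorem hat_add (v w : V3) : hat (v + w) = hat v + hat w := by
  ext i j
  fin_cases i <;> fin_cases j <;> simp [hat] <;> ring

theorem hat_smul (c : ℝ) (v : V3) : hat (c • v) = c • hat v := by
  ext i j
  fin_cases i <;> fin_cases j <;> simp [hat]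

theorem isLinearMap_Pim (A : Matrix (Fin 3) (Fin 3) ℝ) (j k : Fin 3 ⊕ Fin 3) :
    IsLinearMap ℝ (fun q : V3 × V3 => Pim (fun p => A *ᵥ p.2) q j k) := by
  constructor
  · intro x y
    rcases j with j | j <;> rcases k with k | k <;>
      simp [Pim, hat_add, mulVec_add] <;> ring
  · intro c x
    rcases j with j | j <;> rcases k with k | k <;>
      simp [Pim, hat_add, hat_smul, mulVec_smul] <;> ring

theorem fderiv_Pim_affine (A : Matrix (Fin 3) (Fin 3) ℝ) (μ0 : V3) (j k : Fin 3 ⊕ Fin 3)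
    (p v : V3 × V3) :
    fderiv ℝ (fun q => Pim (fun p => A *ᵥ p.2 + μ0) q j k) p v
      = Pim (fun p => A *ᵥ p.2) v j k := by
  refine fderiv_apply_of_linear_add_const (isLinearMap_Pim A j k)
    (Pim (fun p => A *ᵥ p.2 + μ0) 0 j k) (fun x => ?_) p v
  rcases j with j | j <;> rcases k with k | k <;> 
    simp [Pim, hat_zero, hat_add, add_assoc]

theorem eq_transpose_of_dotProduct_eq_zero {A : Matrix (Fin 3) (Fin 3) ℝ}
    (h : ∀ γ : V3, γ ⬝ᵥ ![A 2 1 - A 1 2, A 0 2 - A 2 0, A 1 0 - A 0 1] = 0) : A = Aᵀ := by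
  have h0 := h ![1, 0, 0]
  have h1 := h ![0, 1, 0]
  have h2 := h ![0, 0, 1]
  simp [dotProduct, Fin.sum_univ_three] at h0 h1 h2
  ext i j
  fin_cases i <;> fin_cases j <;> simp <;> linarith

theorem dotProduct_curl3_affine (A : Matrix (Fin 3) (Fin 3) ℝ) (μ0 γ : V3) :
    γ ⬝ᵥ curl3 (fun x => A *ᵥ x + μ0) γ
      = γ ⬝ᵥ ![A 2 1 - A 1 2, A 0 2 - A 2 0, A 1 0 - A 0 1] := by
  simp only [curl3, grad3_affine]

theorem JacobiIdentity.eq_transpose {A : Matrix (Fin 3) (Fin 3) ℝ} {μ0 : V3}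
    (h : JacobiIdentity (fun p => A *ᵥ p.2 + μ0)) : A = Aᵀ := by
  refine eq_transpose_of_dotProduct_eq_zero fun γ => ?_
  have h' := h (0, γ) (Sum.inl 0) (Sum.inl 1) (Sum.inl 2)
  simp only [fderiv_Pim_affine] at h'
  simp [Fintype.sum_sum_type, Fin.sum_univ_three, Pim, dir, hat] at h'
  simp [dotProduct, Fin.sum_univ_three]
  linarith

set_option maxHeartbeats 4000000 in
theorem jacobiIdentity_of_eq_transpose {A : Matrix (Fin 3) (Fin 3) ℝ} (μ0 : V3)
    (h : A = Aᵀ) : JacobiIdentity (fun p => A *ᵥ p.2 + μ0) := by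
  have h10 : A 1 0 = A 0 1 := congrFun (congrFun h 1) 0
  have h20 : A 2 0 = A 0 2 := congrFun (congrFun h 2) 0
  have h21 : A 2 1 = A 1 2 := congrFun (congrFun h 2) 1
  rintro ⟨M, γ⟩ i j k
  simp only [fderiv_Pim_affine]
  rcases i with i | i <;> rcases j with j | j <;> rcases k with k | k <;>
    fin_cases i <;> fin_cases j <;> fin_cases k <;>
    simp [Fintype.sum_sum_type, Fin.sum_univ_three, Pim, dir, hat, h10, h20, h21] <;> ring

/-- For μ(γ) = Aγ + μ₀ : γ·curl_γ μ = 0 everywhere (equivalently Π_μ satisfies the Jacobi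
identity) iff A is symmetric. -/
theorem statement12 (A : Matrix (Fin 3) (Fin 3) ℝ) (μ0 : V3) :
    ((∀ γ : V3, γ ⬝ᵥ curl3 (fun x => A *ᵥ x + μ0) γ = 0) ↔ A = Aᵀ) ∧
    (JacobiIdentity (fun p => A *ᵥ p.2 + μ0) ↔ A = Aᵀ) := by
  refine ⟨⟨fun h => ?_, fun h γ => ?_⟩,
    JacobiIdentity.eq_transpose, jacobiIdentity_of_eq_transpose μ0⟩
  · exact eq_transpose_of_dotProduct_eq_zero fun γ => dotProduct_curl3_affine A μ0 γ ▸ h γ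
  · have h10 : A 1 0 = A 0 1 := congrFun (congrFun h 1) 0
    have h20 : A 2 0 = A 0 2 := congrFun (congrFun h 2) 0
    have h21 : A 2 1 = A 1 2 := congrFun (congrFun h 2) 1
    rw [dotProduct_curl3_affine]
    simp [h10, h20, h21]
end
end

section
/- Let a : ℝ → ℝ, b : ℝ³×ℝ → ℝ, φ : ℝ³ → ℝ be smooth with a(s) ≠ 0 for all s, let A : ℝ → ℝ be a smooth function with A′(s) = 1/a(s) for all s, and define μ(M,γ) = a(M·γ)∇_γφ(γ) + b(γ, M·γ)γ. Then the function C(M,γ) = A(M·γ) + φ(γ) is a Casimir of Π_μ, i.e. Π_μ(M,γ)∇C(M,γ) = 0 for all (M,γ) ∈ ℝ³×ℝ³. -/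
open Matrix

noncomputable section

/-- The derivative of `p ↦ A (p.1 ⬝ᵥ p.2) + φ p.2` along `v`. -/
theorem fderiv_comp_dotProduct_add {A : ℝ → ℝ} {φ : V3 → ℝ} {A' : ℝ} (p v : V3 × V3)
    (hA : HasDerivAt A A' (p.1 ⬝ᵥ p.2)) (hφ : DifferentiableAt ℝ φ p.2) :
    fderiv ℝ (fun q : V3 × V3 => A (q.1 ⬝ᵥ q.2) + φ q.2) p v
      = A' * (p.1 ⬝ᵥ v.2 + v.1 ⬝ᵥ p.2) + fderiv ℝ φ p.2 v.2 := by
  have h₁ (i : Fin 3) : HasFDerivAt (fun q : V3 × V3 => q.1 i)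
      ((ContinuousLinearMap.proj i).comp (ContinuousLinearMap.fst ℝ V3 V3)) p :=
    ((ContinuousLinearMap.proj i).comp (ContinuousLinearMap.fst ℝ V3 V3)).hasFDerivAt
  have h₂ (i : Fin 3) : HasFDerivAt (fun q : V3 × V3 => q.2 i)
      ((ContinuousLinearMap.proj i).comp (ContinuousLinearMap.snd ℝ V3 V3)) p :=
    ((ContinuousLinearMap.proj i).comp (ContinuousLinearMap.snd ℝ V3 V3)).hasFDerivAt
  have hdot := HasFDerivAt.fun_sum (u := Finset.univ) fun i _ => (h₁ i).mul (h₂ i)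
  have hsnd := hφ.hasFDerivAt.comp p (hasFDerivAt_snd (𝕜 := ℝ) (p := p))
  have h := (hA.comp_hasFDerivAt p hdot).add hsnd
  refine (congrArg (· v) h.fderiv).trans ?_
  simp [dotProduct, Fin.sum_univ_three]
  ring

/-- For μ(M,γ) = a(M·γ)∇_γφ(γ) + b(γ,M·γ)γ with a nonvanishing and A′ = 1/a,
C(M,γ) = A(M·γ) + φ(γ) is a Casimir of Π_μ. -/
theorem statement17 (a : ℝ → ℝ) (b : V3 × ℝ → ℝ) (φ : V3 → ℝ) (A : ℝ → ℝ)
    (ha : ContDiff ℝ (⊤ : ℕ∞) a) (hb : ContDiff ℝ (⊤ : ℕ∞) b)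
    (hφ : ContDiff ℝ (⊤ : ℕ∞) φ) (hA : ContDiff ℝ (⊤ : ℕ∞) A)
    (ha0 : ∀ s : ℝ, a s ≠ 0) (hA' : ∀ s : ℝ, HasDerivAt A (1 / a s) s) :
    IsCasimir
      (fun p => a (p.1 ⬝ᵥ p.2) • grad3 φ p.2 + b (p.2, p.1 ⬝ᵥ p.2) • p.2)
      (fun p => A (p.1 ⬝ᵥ p.2) + φ p.2) := by
  intro p
  have hgrad : gradFull (fun q => A (q.1 ⬝ᵥ q.2) + φ q.2) p = fun l =>
      1 / a (p.1 ⬝ᵥ p.2) * (p.1 ⬝ᵥ (dir l).2 + (dir l).1 ⬝ᵥ p.2) + fderiv ℝ φ p.2 (dir l).2 :=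
    funext fun l => fderiv_comp_dotProduct_add p (dir l) (hA' _)
      (hφ.differentiable (by simp) p.2)
  have ha_ne := ha0 (p.1 ⬝ᵥ p.2)
  rw [hgrad]
  ext l
  simp only [mulVec, Pim]
  generalize p.1 ⬝ᵥ p.2 = s at ha_ne ⊢
  rcases l with l | l <;> fin_cases l <;>
    simp [dotProduct, Fin.sum_univ_three, hat, dir, grad3] <;> field_simp <;> ring
end
end

section
/- Let μ : ℝ³ × {γ ∈ ℝ³ : γ₃ ≠ 0} → ℝ³ be given by μ(M,γ) = (0, 0, (M·γ)/γ₃) (the Borisov–Mamaev gyroscopic torque along the third axis of inertia). Then the function C(M,γ) = γ₃ (M·γ) is a Casimir of Π_μ on this domain, i.e. Π_μ(M,γ)∇C(M,γ) = 0 for all M ∈ ℝ³ and all γ ∈ ℝ³ with γ₃ ≠ 0. -/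
open Matrix

noncomputable section

/-- The derivative of `γ₃ (M·γ)` at `(M, γ)`, evaluated on the vector `v`. -/
theorem fderiv_third_mul_dotProduct (M γ : V3) (v : V3 × V3) :
    fderiv ℝ (fun p : V3 × V3 => p.2 2 * (p.1 ⬝ᵥ p.2)) (M, γ) v =
      γ 2 * (M ⬝ᵥ v.2 + v.1 ⬝ᵥ γ) + v.2 2 * (M ⬝ᵥ γ) := by
  have hM (i : Fin 3) : HasFDerivAt (fun p : V3 × V3 => p.1 i)
      ((ContinuousLinearMap.proj i).comp (ContinuousLinearMap.fst ℝ V3 V3)) (M, γ) :=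
    ((ContinuousLinearMap.proj i).comp (ContinuousLinearMap.fst ℝ V3 V3)).hasFDerivAt
  have hγ (i : Fin 3) : HasFDerivAt (fun p : V3 × V3 => p.2 i)
      ((ContinuousLinearMap.proj i).comp (ContinuousLinearMap.snd ℝ V3 V3)) (M, γ) :=
    ((ContinuousLinearMap.proj i).comp (ContinuousLinearMap.snd ℝ V3 V3)).hasFDerivAt
  have h := (hγ 2).fun_mul (HasFDerivAt.fun_sum (u := Finset.univ) fun i _ => (hM i).fun_mul (hγ i))
  simp only [dotProduct]
  rw [h.fderiv]
  simp [Fin.sum_univ_three]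
  ring

/-- For the Borisov–Mamaev torque μ(M,γ) = (0,0,(M·γ)/γ₃), the function
C(M,γ) = γ₃(M·γ) is a Casimir of Π_μ on the set γ₃ ≠ 0. -/
theorem statement19 :
    ∀ (M γ : V3), γ 2 ≠ 0 →
      Pim (fun p : V3 × V3 => ![0, 0, (p.1 ⬝ᵥ p.2) / p.2 2]) (M, γ) *ᵥ
        gradFull (fun p : V3 × V3 => p.2 2 * (p.1 ⬝ᵥ p.2)) (M, γ) = 0 := by
  intro M γ hγ
  have hgrad : gradFull (fun p : V3 × V3 => p.2 2 * (p.1 ⬝ᵥ p.2)) (M, γ) = fun l =>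
      γ 2 * (M ⬝ᵥ (dir l).2 + (dir l).1 ⬝ᵥ γ) + (dir l).2 2 * (M ⬝ᵥ γ) :=
    funext fun l => fderiv_third_mul_dotProduct M γ (dir l)
  rw [hgrad]
  ext i
  rcases i with i | i <;> fin_cases i <;>
    simp [Pim, hat, dir, Matrix.mulVec, dotProduct, Fin.sum_univ_three] <;>
    field_simp <;> ring
end
end
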